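/- arXiv:1803.04052 — 4 statements merged into one kernel-verified Lean document; each statement's English description precedes it below -/
import Mathlib

section
/- For the terms b_k = C(n,k)^2 · a^{-k} (0 ≤ k ≤ n), the ratio of consecutive terms satisfies b_{k+1}/b_k = ((n−k)/(k+1))^2 / a, which is strictly decreasing in k; consequently the sequence (b_k) is unimodal, and every index k at which b_k is maximal lies in the interval [ n/(1+√a) − √a/(1+√a) , n/(1+√a) + 1/(1+√a) ]. -/
theorem choose_sq_div_pow_pos {n k : ℕ} {a : ℝ} (ha : 0 < a) (hk : k ≤ n) :
    0 < (n.choose k : ℝ) ^ 2 / a ^ k := by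
  have : (0 : ℝ) < n.choose k := by exact_mod_cast Nat.choose_pos hk
  positivity

theorem choose_sq_div_pow_ratio {n k : ℕ} {a : ℝ} (ha : 0 < a) (hk : k ≤ n) :
    (n.choose (k + 1) : ℝ) ^ 2 / a ^ (k + 1) / ((n.choose k : ℝ) ^ 2 / a ^ k) =
      (((n : ℝ) - k) / ((k : ℝ) + 1)) ^ 2 / a := by
  have hc : (n.choose k : ℝ) ≠ 0 := by exact_mod_cast (Nat.choose_pos hk).ne'
  have hs : (n.choose (k + 1) : ℝ) * (k + 1) = n.choose k * ((n : ℝ) - k) := by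
    have := Nat.choose_succ_right_eq n k
    rw [← Nat.cast_sub hk]
    exact_mod_cast this
  have hk1 : (k : ℝ) + 1 ≠ 0 := by positivity
  have hs' : (n.choose (k + 1) : ℝ) = n.choose k * (((n : ℝ) - k) / (k + 1)) := by
    rw [← mul_div_assoc, eq_div_iff hk1, hs]
  rw [hs']
  field_simp
  ring

theorem choose_sq_div_pow_le_succ_iff {n k : ℕ} {a : ℝ} (ha : 0 < a) (hk : k ≤ n) :
    (n.choose k : ℝ) ^ 2 / a ^ k ≤ (n.choose (k + 1) : ℝ) ^ 2 / a ^ (k + 1) ↔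
      √a * (k + 1) ≤ n - k := by
  have hkn : (0 : ℝ) ≤ n - k := sub_nonneg.2 (by exact_mod_cast hk)
  rw [← one_le_div (choose_sq_div_pow_pos ha hk), choose_sq_div_pow_ratio ha hk, one_le_div ha,
    ← Real.sqrt_le_left (div_nonneg hkn (by positivity)), le_div_iff₀ (by positivity)]

theorem choose_sq_div_pow_succ_le_iff {n k : ℕ} {a : ℝ} (ha : 0 < a) (hk : k ≤ n) :
    (n.choose (k + 1) : ℝ) ^ 2 / a ^ (k + 1) ≤ (n.choose k : ℝ) ^ 2 / a ^ k ↔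
      n - k ≤ √a * (k + 1) := by
  have hkn : (0 : ℝ) ≤ n - k := sub_nonneg.2 (by exact_mod_cast hk)
  rw [← div_le_one (choose_sq_div_pow_pos ha hk), choose_sq_div_pow_ratio ha hk, div_le_one ha,
    ← Real.le_sqrt (div_nonneg hkn (by positivity)) ha.le, div_le_iff₀ (by positivity)]


theorem stmt11 (n : ℕ) (hn : 1 ≤ n) (a : ℝ) (ha : 0 < a) :
    -- the ratio of consecutive terms
    (∀ k : ℕ, k ≤ n →
      ((n.choose (k+1) : ℝ))^2 / a^(k+1) / (((n.choose k : ℝ))^2 / a^k) =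
        (((n : ℝ) - k) / ((k : ℝ) + 1))^2 / a) ∧
    -- the ratio is strictly decreasing in k
    (∀ k₁ k₂ : ℕ, k₁ < k₂ → k₂ ≤ n →
      (((n : ℝ) - k₂) / ((k₂ : ℝ) + 1))^2 / a < (((n : ℝ) - k₁) / ((k₁ : ℝ) + 1))^2 / a) ∧
    -- the sequence (b_k)_{k=0}^n is unimodal
    (∃ m : ℕ, m ≤ n ∧
      (∀ k₁ k₂ : ℕ, k₁ ≤ k₂ → k₂ ≤ m →
        ((n.choose k₁ : ℝ))^2 / a^k₁ ≤ ((n.choose k₂ : ℝ))^2 / a^k₂) ∧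
      (∀ k₁ k₂ : ℕ, m ≤ k₁ → k₁ ≤ k₂ → k₂ ≤ n →
        ((n.choose k₂ : ℝ))^2 / a^k₂ ≤ ((n.choose k₁ : ℝ))^2 / a^k₁)) ∧
    -- every maximizing index lies in the stated interval
    (∀ m : ℕ, m ≤ n →
      (∀ k : ℕ, k ≤ n → ((n.choose k : ℝ))^2 / a^k ≤ ((n.choose m : ℝ))^2 / a^m) →
      ((n : ℝ) / (1 + Real.sqrt a) - Real.sqrt a / (1 + Real.sqrt a) ≤ (m : ℝ) ∧
        (m : ℝ) ≤ (n : ℝ) / (1 + Real.sqrt a) + 1 / (1 + Real.sqrt a))) := by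
  refine ⟨fun k hk => choose_sq_div_pow_ratio ha hk, fun k₁ k₂ h h₂ => ?_, ?_, fun m hm hmax => ?_⟩
  · have h' : (k₁ : ℝ) < k₂ := by exact_mod_cast h
    have h₂' : (k₂ : ℝ) ≤ n := by exact_mod_cast h₂
    have : (0 : ℝ) ≤ n - k₂ := sub_nonneg.2 h₂'
    gcongr
    linarith
  · classical
    have hex : ∃ k : ℕ, (n : ℝ) - k ≤ √a * (k + 1) := ⟨n, by rw [sub_self]; positivity⟩
    have hle : Nat.find hex ≤ n := Nat.find_min' hex (by rw [sub_self]; positivity)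
    refine ⟨Nat.find hex, hle, fun k₁ k₂ h h₂ => ?_, fun k₁ k₂ h₁ h h₂ => ?_⟩
    · induction k₂, h using Nat.le_induction with
      | base => exact le_rfl
      | succ k _ ih =>
        exact (ih (by omega)).trans <| (choose_sq_div_pow_le_succ_iff ha (by omega)).2
          (not_le.1 (Nat.find_min hex h₂)).le
    · induction k₂, h using Nat.le_induction with
      | base => exact le_rfl
      | succ k hk ih =>
        refine ((choose_sq_div_pow_succ_le_iff ha (by omega)).2 ?_).trans (ih (by omega))
        have hfk : ((Nat.find hex : ℕ) : ℝ) ≤ k := by exact_mod_cast h₁.trans hk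
        calc (n : ℝ) - k ≤ n - (Nat.find hex : ℕ) := by linarith
          _ ≤ √a * ((Nat.find hex : ℕ) + 1) := Nat.find_spec hex
          _ ≤ √a * (k + 1) := by gcongr
  · have hs : 0 < 1 + √a := by positivity
    rw [← sub_div, ← add_div, div_le_iff₀ hs, le_div_iff₀ hs]
    constructor
    · have : (n : ℝ) - m ≤ √a * (m + 1) := by
        rw [← choose_sq_div_pow_succ_le_iff ha hm]
        rcases hm.eq_or_lt with rfl | hlt
        · rw [Nat.choose_succ_self]
          simpa using (choose_sq_div_pow_pos ha le_rfl).le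
        · exact hmax _ hlt
      linarith
    · cases m with
      | zero => simp; positivity
      | succ k =>
        have := (choose_sq_div_pow_le_succ_iff ha (by omega)).1 (hmax k (by omega))
        push_cast
        linarith
end

section
/- Alphabet of constant size (case α = 0): for fixed real a > 1, Σ_{k=1}^{n} C(n,k)^2 · a^{-k} ∼ (a^{1/4} / (2 √(π n))) · (1 + 1/√a)^{2n+1} as n → ∞, i.e., the ratio of the two sides tends to 1. -/
open Filter Real

/-- Parseval's identity for `(1 + bX) ^ n`. -/
lemma sum_choose_sq_mul_pow_eq_integral (b : ℝ) (n : ℕ) :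
    ∑ k ∈ Finset.range (n + 1), ((n.choose k : ℝ) * b ^ k) ^ 2 =
      (2 * π)⁻¹ * ∫ θ in -π..π, (1 + b ^ 2 + 2 * b * cos θ) ^ n := by
  let p : Polynomial ℂ := (1 + Polynomial.C (b : ℂ) * Polynomial.X) ^ n
  have hp : p = ((1 + Polynomial.X) ^ n : Polynomial ℂ).comp
      (Polynomial.C (b : ℂ) * Polynomial.X) := by
    simp [p]
  have hcoeff (k : ℕ) : p.coeff k = (n.choose k : ℂ) * (b : ℂ) ^ k := by
    rw [hp, Polynomial.comp_C_mul_X_coeff, Polynomial.coeff_one_add_X_pow]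
  have hsupp : p.support ⊆ Finset.range (n + 1) := by
    intro k hk
    by_contra h
    rw [Polynomial.mem_support_iff, hcoeff, Nat.choose_eq_zero_of_lt (by simpa using h)] at hk
    simp at hk
  have hsum : ∑ k ∈ p.support, ‖p.coeff k‖ ^ 2 =
      ∑ k ∈ Finset.range (n + 1), ((n.choose k : ℝ) * b ^ k) ^ 2 := by
    rw [Finset.sum_subset hsupp fun k _ hk => by simp [Polynomial.notMem_support_iff.1 hk]]
    refine Finset.sum_congr rfl fun k _ => ?_
    rw [hcoeff, ← Complex.ofReal_natCast, ← Complex.ofReal_pow, ← Complex.ofReal_mul,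
      Complex.norm_real, norm_eq_abs, sq_abs]
  have hnorm (θ : ℝ) : ‖p.eval (circleMap 0 1 θ)‖ ^ 2 = (1 + b ^ 2 + 2 * b * cos θ) ^ n := by
    have : ‖1 + (b : ℂ) * circleMap 0 1 θ‖ ^ 2 = 1 + b ^ 2 + 2 * b * cos θ := by
      rw [← Complex.normSq_eq_norm_sq, Complex.normSq_apply]
      simp [circleMap, Complex.exp_ofReal_mul_I_re, Complex.exp_ofReal_mul_I_im]
      nlinarith [sin_sq_add_cos_sq θ]
    simp only [p, Polynomial.eval_pow, Polynomial.eval_add, Polynomial.eval_one,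
      Polynomial.eval_mul, Polynomial.eval_C, Polynomial.eval_X, norm_pow]
    rw [← pow_mul, mul_comm n 2, pow_mul, this]
  rw [← hsum, Polynomial.sum_sq_norm_coeff_eq_circleAverage,
    circleAverage_eq_integral_add (-π), smul_eq_mul]
  simp only [hnorm]
  rw [intervalIntegral.integral_comp_add_right
    (fun θ => (1 + b ^ 2 + 2 * b * cos θ) ^ n)]
  ring_nf

lemma tendsto_nat_mul_one_sub_cos_div_sqrt (t : ℝ) :
    Tendsto (fun n : ℕ => (n : ℝ) * (1 - cos (t / √n))) atTop (nhds (t ^ 2 / 2)) := by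
  have hinv : Tendsto (fun n : ℕ => (√(n : ℝ))⁻¹) atTop (nhds 0) :=
    (tendsto_sqrt_atTop.comp tendsto_natCast_atTop_atTop).inv_tendsto_atTop
  have h0 : Tendsto (fun n : ℕ => t / √(n : ℝ)) atTop (nhds 0) := by
    simpa [div_eq_mul_inv] using hinv.const_mul t
  have hlow : Tendsto (fun n : ℕ => t ^ 2 / 2 - (t / √(n : ℝ)) ^ 2 * t ^ 2 * (5 / 96)) atTop
      (nhds (t ^ 2 / 2)) := by
    simpa using (((h0.pow 2).mul_const (t ^ 2)).mul_const (5 / 96)).const_sub (t ^ 2 / 2)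
  have hsq {n : ℕ} (hn : 0 < n) : (n : ℝ) * (t / √n) ^ 2 = t ^ 2 := by
    rw [div_pow, sq_sqrt n.cast_nonneg]
    field_simp
  refine tendsto_of_tendsto_of_tendsto_of_le_of_le' hlow tendsto_const_nhds ?_ ?_
  · filter_upwards [eventually_gt_atTop 0, h0.abs.eventually_le_const (u := 1) (by simp)]
      with n hn ht
    have h := mul_le_mul_of_nonneg_left (abs_le.1 (cos_bound ht)).2 n.cast_nonneg
    have h4 : |t / √(n : ℝ)| ^ 4 = (t / √n) ^ 2 * (t / √n) ^ 2 := by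
      rw [Even.pow_abs (by decide)]; ring
    rw [h4] at h
    linear_combination h + ((t / √(n : ℝ)) ^ 2 * (5 / 96) - 1 / 2) * hsq hn
  · filter_upwards [eventually_gt_atTop 0] with n hn
    have h := mul_le_mul_of_nonneg_left (one_sub_sq_div_two_le_cos (x := t / √n)) n.cast_nonneg
    linear_combination h + (1 / 2) * hsq hn

/-- Laplace's method for powers of `1 - q / 2 * (1 - cos θ)`. -/
lemma tendsto_sqrt_mul_integral_pow {q : ℝ} (hq : 0 < q) (hq1 : q ≤ 1) :
    Tendsto (fun n : ℕ => √n * ∫ θ in -π..π, (1 - q / 2 * (1 - cos θ)) ^ n) atTop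
      (nhds √(4 * π / q)) := by
  let F : ℕ → ℝ → ℝ := fun n => (Set.Ioc (-π * √n) (π * √n)).indicator
    fun t => (1 - q / 2 * (1 - cos (t / √n))) ^ n
  have hF (n : ℕ) (hn : 0 < n) :
      ∫ t, F n t = √n * ∫ θ in -π..π, (1 - q / 2 * (1 - cos θ)) ^ n := by
    have hs : 0 < √(n : ℝ) := by positivity
    rw [MeasureTheory.integral_indicator measurableSet_Ioc,
      ← intervalIntegral.integral_of_le (by nlinarith [pi_pos]),
      intervalIntegral.integral_comp_div (fun θ => (1 - q / 2 * (1 - cos θ)) ^ n) hs.ne',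
      mul_div_cancel_right₀ _ hs.ne', mul_div_cancel_right₀ _ hs.ne', smul_eq_mul]
  have hlim : Tendsto (fun n : ℕ => ∫ t, F n t) atTop (nhds (∫ t, exp (-(q / 4) * t ^ 2))) := by
    refine MeasureTheory.tendsto_integral_filter_of_dominated_convergence
      (fun t => exp (-(q / π ^ 2) * t ^ 2)) ?_ ?_
      (integrable_exp_neg_mul_sq (by positivity)) ?_
    · refine Eventually.of_forall fun n => ?_
      refine (Continuous.aestronglyMeasurable ?_).indicator measurableSet_Ioc
      fun_prop
    · filter_upwards [eventually_gt_atTop 0] with n hn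
      refine Eventually.of_forall fun t => ?_
      have hs : 0 < √(n : ℝ) := by positivity
      by_cases ht : t ∈ Set.Ioc (-π * √n) (π * √n)
      · simp only [F, Set.indicator_of_mem ht]
        have hx : |t / √(n : ℝ)| ≤ π := by
          rw [abs_le, le_div_iff₀ hs, div_le_iff₀ hs]
          exact ⟨ht.1.le, ht.2⟩
        have hcos := cos_le_one_sub_mul_cos_sq hx
        have h0 : 0 ≤ 1 - q / 2 * (1 - cos (t / √n)) := by
          nlinarith [neg_one_le_cos (t / √(n : ℝ))]
        rw [norm_of_nonneg (pow_nonneg h0 n)]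
        have hle : 1 - q / 2 * (1 - cos (t / √n)) ≤ exp (-(q / π ^ 2) * (t / √n) ^ 2) := by
          refine le_trans ?_ (add_one_le_exp _)
          linear_combination q / 2 * hcos
        refine (pow_le_pow_left₀ h0 hle n).trans_eq ?_
        rw [← exp_nat_mul, div_pow, sq_sqrt n.cast_nonneg]
        congr 1
        field_simp
      · simp only [F, Set.indicator_of_notMem ht, norm_zero]
        positivity
    · refine Eventually.of_forall fun t => ?_
      have hpow : Tendsto (fun n : ℕ => (1 + -(q / 2 * (1 - cos (t / √n)))) ^ n) atTop
          (nhds (exp (-(q / 4) * t ^ 2))) := by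
        refine tendsto_one_add_pow_exp_of_tendsto ?_
        convert! (tendsto_nat_mul_one_sub_cos_div_sqrt t).const_mul (-(q / 2)) using 2 <;> ring
      refine hpow.congr' ?_
      have hbig : Tendsto (fun n : ℕ => π * √(n : ℝ)) atTop atTop :=
        (tendsto_sqrt_atTop.comp tendsto_natCast_atTop_atTop).const_mul_atTop pi_pos
      filter_upwards [hbig.eventually_gt_atTop |t|] with n hn
      have ht : t ∈ Set.Ioc (-π * √n) (π * √n) :=
        ⟨by linarith [neg_abs_le t], by linarith [le_abs_self t]⟩
      simp only [F, Set.indicator_of_mem ht, ← sub_eq_add_neg]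
  rw [integral_gaussian, show π / (q / 4) = 4 * π / q by field_simp] at hlim
  refine hlim.congr' ?_
  filter_upwards [eventually_gt_atTop 0] with n hn using hF n hn

lemma tendsto_sqrt_mul_sum_choose_sq_mul_pow_div {b : ℝ} (hb : 0 < b) :
    Tendsto (fun n : ℕ => √n * (∑ k ∈ Finset.range (n + 1), ((n.choose k : ℝ) * b ^ k) ^ 2) /
      (1 + b) ^ (2 * n)) atTop (nhds ((1 + b) / (2 * √(π * b)))) := by
  have hq : 0 < 4 * b / (1 + b) ^ 2 := by positivity
  have hq1 : 4 * b / (1 + b) ^ 2 ≤ 1 := by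
    rw [div_le_one (by positivity)]
    nlinarith [sq_nonneg (1 - b)]
  have hconst : (2 * π)⁻¹ * √(4 * π / (4 * b / (1 + b) ^ 2)) = (1 + b) / (2 * √(π * b)) := by
    have h : 4 * π / (4 * b / (1 + b) ^ 2) = (π * (1 + b) / √(π * b)) ^ 2 := by
      rw [div_pow, sq_sqrt (by positivity)]
      field_simp
    rw [h, sqrt_sq (by positivity)]
    field_simp
  rw [← hconst]
  refine ((tendsto_sqrt_mul_integral_pow hq hq1).const_mul (2 * π)⁻¹).congr fun n => ?_
  have hint : ∫ θ in -π..π, (1 + b ^ 2 + 2 * b * cos θ) ^ n =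
      (1 + b) ^ (2 * n) * ∫ θ in -π..π, (1 - 4 * b / (1 + b) ^ 2 / 2 * (1 - cos θ)) ^ n := by
    rw [← intervalIntegral.integral_const_mul]
    refine intervalIntegral.integral_congr fun θ _ => ?_
    simp only [pow_mul, ← mul_pow]
    congr 1
    field_simp
    ring
  rw [sum_choose_sq_mul_pow_eq_integral, hint]
  field_simp

theorem stmt12 (a : ℝ) (ha : 1 < a) :
    Tendsto (fun n : ℕ =>
        (∑ k ∈ Finset.Icc 1 n, ((n.choose k : ℝ))^2 / a^k) /
          (a ^ ((1 : ℝ)/4) / (2 * Real.sqrt (Real.pi * n)) *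
            (1 + 1 / Real.sqrt a)^(2*n+1)))
      atTop (nhds 1) := by
  have ha0 : 0 < a := by linarith
  set b : ℝ := 1 / √a with hb_def
  have hb : 0 < b := by positivity
  have hb2 : b ^ 2 = a⁻¹ := by rw [hb_def, div_pow, sq_sqrt ha0.le]; simp
  have hab : a ^ ((1 : ℝ) / 4) * √b = 1 := by
    rw [hb_def, sqrt_div zero_le_one, sqrt_one, sqrt_eq_rpow, sqrt_eq_rpow, ← rpow_mul ha0.le]
    norm_num
    field_simp
  set c : ℝ := (1 + b) / (2 * √(π * b)) with hc_def
  have hc : 0 < c := by positivity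
  have hden (n : ℕ) (hn : 0 < n) : a ^ ((1 : ℝ) / 4) / (2 * √(π * n)) * (1 + b) ^ (2 * n + 1) =
      c * (1 + b) ^ (2 * n) / √n := by
    rw [hc_def, sqrt_mul pi_pos.le, sqrt_mul pi_pos.le, pow_succ]
    have : a ^ ((1 : ℝ) / 4) = 1 / √b := by rw [eq_div_iff (by positivity), hab]
    rw [this]
    field_simp
  have hsum (n : ℕ) : ∑ k ∈ Finset.Icc 1 n, (n.choose k : ℝ) ^ 2 / a ^ k =
      ∑ k ∈ Finset.range (n + 1), ((n.choose k : ℝ) * b ^ k) ^ 2 - 1 := by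
    have hterm (k : ℕ) : ((n.choose k : ℝ) * b ^ k) ^ 2 = (n.choose k : ℝ) ^ 2 / a ^ k := by
      rw [mul_pow, ← pow_mul, mul_comm k 2, pow_mul, hb2, inv_pow, div_eq_mul_inv]
    rw [Finset.range_eq_Ico, Finset.sum_eq_sum_Ico_succ_bot (by omega)]
    simp only [hterm]
    simp [Finset.Ico_add_one_right_eq_Icc]
  have hsmall : Tendsto (fun n : ℕ => √(n : ℝ) / (1 + b) ^ (2 * n)) atTop (nhds 0) := by
    have h1 : 1 < (1 + b) ^ 2 := by nlinarith
    refine squeeze_zero (fun n => by positivity) (fun n => ?_)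
      (tendsto_pow_const_div_const_pow_of_one_lt 1 h1)
    rw [pow_one, pow_mul]
    gcongr
    rcases n.eq_zero_or_pos with rfl | hn
    · simp
    · rw [sqrt_le_left n.cast_nonneg]
      have : (1 : ℝ) ≤ n := by exact_mod_cast hn
      nlinarith
  have hmain := ((tendsto_sqrt_mul_sum_choose_sq_mul_pow_div hb).sub hsmall).div_const c
  rw [sub_zero, div_self hc.ne'] at hmain
  refine hmain.congr' ?_
  filter_upwards [eventually_gt_atTop 0] with n hn
  rw [hden n hn, hsum]
  field_simp
end

section
/- Growing alphabet, case α ∈ (1, 2): for fixed real a > 0 and fixed α with 1 < α < 2, setting a_n = a·n^α, Σ_{k=1}^{n} C(n,k)^2 · a_n^{-k} ∼ ((a n^α)^{1/4} / (2 √(π n))) · exp( (2/√a)·n^{1−α/2} ) as n → ∞, i.e., the ratio of the two sides tends to 1. -/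
open Filter Real

theorem integral_exp_int_mul_I (m : ℤ) :
    ∫ θ in (-π)..π, Complex.exp (m * θ * Complex.I) = if m = 0 then 2 * (π : ℂ) else 0 := by
  split_ifs with h
  · simp [h]
    ring
  · have hc : (m : ℂ) * Complex.I ≠ 0 := by simp [h]
    have h1 := integral_exp_mul_complex (a := -π) (b := π) hc
    have h2 : ∀ θ : ℝ, (m : ℂ) * θ * Complex.I = m * Complex.I * θ := fun θ => by ring
    simp only [h2, h1]
    have h3 : Complex.exp (m * Complex.I * π) = Complex.exp (m * Complex.I * ((-π : ℝ) : ℂ)) := by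
      rw [Complex.exp_eq_exp_iff_exists_int]
      exact ⟨m, by push_cast; ring⟩
    rw [h3, sub_self, zero_div]

/-- Parseval's identity for the trigonometric polynomial `(1 + y e^{iθ})^n`. -/
theorem integral_one_add_two_mul_cos_pow (n : ℕ) (y : ℝ) :
    ∫ θ in (-π)..π, (1 + 2 * y * cos θ + y ^ 2) ^ n =
      2 * π * ∑ k ∈ Finset.range (n + 1), (n.choose k : ℝ) ^ 2 * (y ^ 2) ^ k := by
  have key (θ : ℝ) : (((1 + 2 * y * cos θ + y ^ 2) ^ n : ℝ) : ℂ) =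
      ∑ j ∈ Finset.range (n + 1), ∑ k ∈ Finset.range (n + 1),
        ((n.choose j : ℂ) * n.choose k * y ^ j * y ^ k) *
          Complex.exp (((j : ℤ) - (k : ℤ) : ℤ) * θ * Complex.I) := by
    have h1 : (((1 + 2 * y * cos θ + y ^ 2) ^ n : ℝ) : ℂ) =
        (y * Complex.exp (θ * Complex.I) + 1) ^ n *
          (y * Complex.exp (-(θ * Complex.I)) + 1) ^ n := by
      have h0 : Complex.exp (θ * Complex.I) * Complex.exp (-(θ * Complex.I)) = 1 := by
        rw [← Complex.exp_add, add_neg_cancel, Complex.exp_zero]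
      rw [← mul_pow]
      push_cast
      congr 1
      have h2 := Complex.two_cos (θ : ℂ)
      rw [neg_mul] at h2
      linear_combination (y : ℂ) * h2 - (y : ℂ) ^ 2 * h0
    rw [h1, add_pow, add_pow, Finset.sum_mul_sum]
    refine Finset.sum_congr rfl fun j _ => Finset.sum_congr rfl fun k _ => ?_
    have h3 : Complex.exp (((j : ℤ) - (k : ℤ) : ℤ) * θ * Complex.I) =
        Complex.exp (θ * Complex.I) ^ j * Complex.exp (-(θ * Complex.I)) ^ k := by
      rw [← Complex.exp_nat_mul, ← Complex.exp_nat_mul, ← Complex.exp_add]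
      congr 1
      push_cast
      ring
    rw [h3]
    simp only [mul_pow, one_pow, mul_one]
    ring
  apply Complex.ofReal_injective
  rw [← intervalIntegral.integral_ofReal]
  simp only [key]
  have hint (j k : ℕ) (c : ℂ) : IntervalIntegrable (fun θ : ℝ =>
      c * Complex.exp (((j : ℤ) - (k : ℤ) : ℤ) * θ * Complex.I)) MeasureTheory.volume (-π) π :=
    Continuous.intervalIntegrable (by fun_prop) _ _
  rw [intervalIntegral.integral_finsetSum fun j _ =>
    Continuous.intervalIntegrable (by fun_prop) _ _]
  simp only [Complex.ofReal_mul, Complex.ofReal_sum, Complex.ofReal_pow, Complex.ofReal_natCast,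
    Complex.ofReal_ofNat]
  rw [Finset.mul_sum]
  refine Finset.sum_congr rfl fun j hj => ?_
  rw [intervalIntegral.integral_finsetSum fun k _ => hint j k _]
  simp only [intervalIntegral.integral_const_mul, integral_exp_int_mul_I, sub_eq_zero,
    Nat.cast_inj, mul_ite, mul_zero, Finset.sum_ite_eq, hj, if_true]
  ring

/-- The integrand of the rescaled Parseval integral, truncated to one period. -/
noncomputable def laplaceIntegrand (n : ℕ) (y u : ℝ) : ℝ :=
  (Set.Ioc (-π * √(n * y)) (π * √(n * y))).indicator
    (fun u => (1 + -(2 * y * (1 - cos (u / √(n * y)))) / (1 + y) ^ 2) ^ n) u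

theorem sum_choose_sq_eq_integral_laplaceIntegrand {n : ℕ} {y : ℝ} (hn : 0 < n) (hy : 0 < y) :
    ∑ k ∈ Finset.range (n + 1), (n.choose k : ℝ) ^ 2 * (y ^ 2) ^ k =
      ((1 + y) ^ n) ^ 2 / (2 * π * √(n * y)) * ∫ u, laplaceIntegrand n y u := by
  have hx : 0 < √(n * y) := by positivity
  have hpi := pi_pos
  have h1 : ∫ u, laplaceIntegrand n y u = √(n * y) * ∫ θ in (-π)..π,
      (1 + -(2 * y * (1 - cos θ)) / (1 + y) ^ 2) ^ n := by
    unfold laplaceIntegrand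
    rw [MeasureTheory.integral_indicator measurableSet_Ioc,
      ← intervalIntegral.integral_of_le (by nlinarith [mul_pos hpi hx]),
      intervalIntegral.integral_comp_div
        (fun θ => (1 + -(2 * y * (1 - cos θ)) / (1 + y) ^ 2) ^ n) hx.ne',
      mul_div_cancel_right₀ _ hx.ne', mul_div_cancel_right₀ _ hx.ne', smul_eq_mul]
  have h2 : ((1 + y) ^ n) ^ 2 * ∫ θ in (-π)..π, (1 + -(2 * y * (1 - cos θ)) / (1 + y) ^ 2) ^ n =
      ∫ θ in (-π)..π, (1 + 2 * y * cos θ + y ^ 2) ^ n := by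
    rw [← intervalIntegral.integral_const_mul]
    congr 1
    ext θ
    rw [← pow_mul, mul_comm n 2, pow_mul, ← mul_pow]
    congr 1
    field_simp
    ring
  rw [integral_one_add_two_mul_cos_pow] at h2
  rw [h1]
  rw [← mul_assoc, div_mul_eq_mul_div, mul_div_mul_right _ _ hx.ne', div_mul_eq_mul_div, h2,
    mul_div_cancel_left₀ _ (by positivity)]

theorem abs_laplaceIntegrand_le {n : ℕ} {y : ℝ} (hn : 0 < n) (hy : 0 < y) (hy1 : y ≤ 1) (u : ℝ) :
    |laplaceIntegrand n y u| ≤ exp (-(1 / π ^ 2) * u ^ 2) := by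
  have hx : 0 < √(n * y) := by positivity
  have hpi := pi_pos
  unfold laplaceIntegrand
  by_cases hu : u ∈ Set.Ioc (-π * √(n * y)) (π * √(n * y))
  swap
  · rw [Set.indicator_of_notMem hu, abs_zero]; positivity
  rw [Set.indicator_of_mem hu, abs_pow]
  set v := u / √(n * y) with hv
  have hvpi : |v| ≤ π := by
    rw [hv, abs_div, abs_of_pos hx, div_le_iff₀ hx, abs_le]
    exact ⟨by linarith [hu.1], hu.2⟩
  have hcos := cos_le_one_sub_mul_cos_sq hvpi
  have hbase : 0 ≤ 1 + -(2 * y * (1 - cos v)) / (1 + y) ^ 2 := by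
    have h : 1 + -(2 * y * (1 - cos v)) / (1 + y) ^ 2 =
        ((1 - y) ^ 2 + 2 * y * (1 + cos v)) / (1 + y) ^ 2 := by
      field_simp; ring
    rw [h]
    have := neg_one_le_cos v
    have : 0 ≤ 1 + cos v := by linarith
    positivity
  have hle : 1 + -(2 * y * (1 - cos v)) / (1 + y) ^ 2 ≤ exp (-(y * v ^ 2 / π ^ 2)) := by
    have h4 : y * v ^ 2 / π ^ 2 ≤ 2 * y * (1 - cos v) / (1 + y) ^ 2 := by
      rw [le_div_iff₀ (by positivity)]
      have h5 : (1 + y) ^ 2 ≤ 4 := by nlinarith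
      calc y * v ^ 2 / π ^ 2 * (1 + y) ^ 2 ≤ y * v ^ 2 / π ^ 2 * 4 := by gcongr
        _ = 2 * y * (2 / π ^ 2 * v ^ 2) := by ring
        _ ≤ _ := by gcongr; linarith
    have h6 := add_one_le_exp (-(y * v ^ 2 / π ^ 2))
    rw [neg_div]
    linarith
  rw [abs_of_nonneg hbase]
  refine (pow_le_pow_left₀ hbase hle n).trans_eq ?_
  rw [← exp_nat_mul]
  congr 1
  rw [hv, div_pow, sq_sqrt (by positivity)]
  field_simp

theorem tendsto_laplaceIntegrand {y : ℕ → ℝ} (hy : ∀ᶠ n in atTop, 0 < y n)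
    (hy0 : Tendsto y atTop (nhds 0)) (hny : Tendsto (fun n => n * y n) atTop atTop) (u : ℝ) :
    Tendsto (fun n => laplaceIntegrand n (y n) u) atTop (nhds (exp (-1 * u ^ 2))) := by
  have hs : Tendsto (fun n => √(n * y n)) atTop atTop := tendsto_sqrt_atTop.comp hny
  have hsinc : Tendsto (fun n => sinc (u / √(n * y n) / 2)) atTop (nhds 1) := by
    have h : Tendsto (fun n => u / √(n * y n) / 2) atTop (nhds 0) := by
      simpa using (hs.const_div_atTop u).div_const 2
    have := (continuous_sinc.tendsto 0).comp h
    rwa [sinc_zero] at this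
  have hlim : Tendsto (fun n : ℕ =>
      (n : ℝ) * (-(2 * y n * (1 - cos (u / √(n * y n)))) / (1 + y n) ^ 2)) atTop
      (nhds (-1 * u ^ 2)) := by
    have h := ((hsinc.pow 2).const_mul (-1 * u ^ 2)).div ((hy0.const_add 1).pow 2) (by norm_num)
    simp only [one_pow, mul_one, add_zero, div_one] at h
    refine h.congr' ?_
    filter_upwards [hy, eventually_gt_atTop 0] with n hyn hn
    have hx : 0 < √(n * y n) := by positivity
    have hx2 : √(n * y n) ^ 2 = n * y n := sq_sqrt (by positivity)
    set s := √(n * y n)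
    have hcos : 1 - cos (u / s) = 2 * sin (u / s / 2) ^ 2 := by
      have h1 := cos_sq' (u / s / 2)
      have h2 := cos_two_mul (u / s / 2)
      rw [mul_div_cancel₀ _ two_ne_zero] at h2
      linarith
    have hsin : sin (u / s / 2) = u / s / 2 * sinc (u / s / 2) := by
      rcases eq_or_ne (u / s / 2) 0 with h0 | h0
      · simp [h0]
      · rw [sinc_of_ne_zero h0, mul_div_cancel₀ _ h0]
    rw [hcos, hsin, ← mul_div_assoc, Pi.div_apply]
    congr 1
    have : (n : ℝ) * -(2 * y n * (2 * (u / s / 2 * sinc (u / s / 2)) ^ 2)) =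
      -(s ^ 2 * (u / s) ^ 2) * sinc (u / s / 2) ^ 2 := by rw [hx2]; ring
    rw [this, ← mul_pow, mul_div_cancel₀ _ hx.ne']
    ring
  refine (tendsto_one_add_pow_exp_of_tendsto hlim).congr' ?_
  have hbig : ∀ᶠ n in atTop, |u| < π * √(n * y n) :=
    (hs.const_mul_atTop pi_pos).eventually_gt_atTop _
  filter_upwards [hbig] with n hn
  rw [abs_lt] at hn
  rw [laplaceIntegrand, Set.indicator_of_mem]
  exact ⟨by linarith [hn.1], hn.2.le⟩

theorem tendsto_integral_laplaceIntegrand {y : ℕ → ℝ} (hy : ∀ᶠ n in atTop, 0 < y n)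
    (hy0 : Tendsto y atTop (nhds 0)) (hny : Tendsto (fun n => n * y n) atTop atTop) :
    Tendsto (fun n => ∫ u, laplaceIntegrand n (y n) u) atTop (nhds √π) := by
  have hg := integral_gaussian 1
  rw [div_one] at hg
  rw [← hg]
  refine MeasureTheory.tendsto_integral_filter_of_dominated_convergence
    (fun u => exp (-(1 / π ^ 2) * u ^ 2)) ?_ ?_ (integrable_exp_neg_mul_sq (by positivity)) ?_
  · refine Eventually.of_forall fun n => ?_
    refine (Continuous.measurable ?_ |>.indicator measurableSet_Ioc).aestronglyMeasurable
    fun_prop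
  · filter_upwards [hy, hy0.eventually_le_const one_pos, eventually_gt_atTop 0] with n h1 h2 h3
    exact Eventually.of_forall (abs_laplaceIntegrand_le h3 h1 h2)
  · exact Eventually.of_forall (tendsto_laplaceIntegrand hy hy0 hny)

theorem tendsto_one_add_mul_exp_neg_pow {y : ℕ → ℝ} (hy : ∀ᶠ n in atTop, 0 < y n)
    (hny2 : Tendsto (fun n => n * y n ^ 2) atTop (nhds 0)) :
    Tendsto (fun n => ((1 + y n) * exp (-y n)) ^ n) atTop (nhds 1) := by
  have hlim : Tendsto (fun n : ℕ => (n : ℝ) * ((1 + y n) * exp (-y n) - 1)) atTop (nhds 0) := by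
    refine squeeze_zero_norm' ?_ hny2
    filter_upwards [hy] with n hn
    rw [norm_mul, RCLike.norm_natCast]
    gcongr
    rw [norm_eq_abs, abs_le]
    have h1 := add_one_le_exp (y n)
    have h2 := add_one_le_exp (-y n)
    have h3 : exp (y n) * exp (-y n) = 1 := by rw [← exp_add, add_neg_cancel, exp_zero]
    constructor
    · nlinarith
    · nlinarith [exp_pos (-y n), sq_nonneg (y n)]
  simpa using tendsto_one_add_pow_exp_of_tendsto hlim

theorem tendsto_sum_choose_sq_div {y : ℕ → ℝ} (hy : ∀ᶠ n in atTop, 0 < y n)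
    (hny : Tendsto (fun n => n * y n) atTop atTop)
    (hny2 : Tendsto (fun n => n * y n ^ 2) atTop (nhds 0)) :
    Tendsto (fun n : ℕ => (∑ k ∈ Finset.Icc 1 n, (n.choose k : ℝ) ^ 2 * (y n ^ 2) ^ k) /
      (exp (2 * (n * y n)) / (2 * √π * √(n * y n)))) atTop (nhds 1) := by
  have hy0 : Tendsto y atTop (nhds 0) := by
    refine squeeze_zero' (hy.mono fun _ => le_of_lt) ?_ hny2
    filter_upwards [hy, hny.eventually_ge_atTop 1] with n h1 h2
    nlinarith
  have hE := ((tendsto_one_add_mul_exp_neg_pow hy hny2).pow 2).mul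
    ((tendsto_integral_laplaceIntegrand hy hy0 hny).div_const √π)
  have hR : Tendsto (fun n => 2 * √π * (√(n * y n) / exp (2 * (n * y n)))) atTop (nhds 0) := by
    have h : Tendsto (fun x : ℝ => √x / exp (2 * x)) atTop (nhds 0) := by
      have := tendsto_rpow_mul_exp_neg_mul_atTop_nhds_zero (1 / 2) 2 two_pos
      refine this.congr fun x => ?_
      simp only [sqrt_eq_rpow, neg_mul, exp_neg, div_eq_mul_inv]
    simpa using (h.comp hny).const_mul (2 * √π)
  have hpi : √π ≠ 0 := by positivity
  have h := hE.sub hR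
  rw [one_pow, div_self hpi, one_mul, sub_zero] at h
  refine h.congr' ?_
  filter_upwards [hy, eventually_gt_atTop 0] with n hyn hn
  have hsum : ∑ k ∈ Finset.Icc 1 n, (n.choose k : ℝ) ^ 2 * (y n ^ 2) ^ k =
      ((1 + y n) ^ n) ^ 2 / (2 * π * √(n * y n)) * (∫ u, laplaceIntegrand n (y n) u) - 1 := by
    rw [← sum_choose_sq_eq_integral_laplaceIntegrand hn hyn, Finset.range_eq_Ico,
      Finset.sum_eq_sum_Ico_succ_bot (Nat.succ_pos n)]
    simp
    rfl
  have hx : 0 < √(n * y n) := by positivity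
  have hexp : (((1 + y n) * exp (-y n)) ^ n) ^ 2 =
      ((1 + y n) ^ n) ^ 2 / exp (2 * (n * y n)) := by
    rw [mul_pow, ← exp_nat_mul, mul_pow, ← exp_nat_mul, div_eq_mul_inv, ← exp_neg]
    congr 2
    push_cast
    ring
  have hpi2 : π = √π ^ 2 := (sq_sqrt pi_pos.le).symm
  rw [hsum, hexp]
  generalize (∫ u, laplaceIntegrand n (y n) u) = J
  have hdiv : ((1 + y n) ^ n) ^ 2 / (2 * π * √(n * y n)) =
      ((1 + y n) ^ n) ^ 2 / (2 * √π ^ 2 * √(n * y n)) := by rw [← hpi2]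
  rw [hdiv]
  field_simp

theorem stmt15 (a α : ℝ) (ha : 0 < a) (hα₁ : 1 < α) (hα₂ : α < 2) :
    Tendsto (fun n : ℕ =>
        (∑ k ∈ Finset.Icc 1 n, ((n.choose k : ℝ))^2 / (a * (n : ℝ)^α)^k) /
          ((a * (n : ℝ)^α) ^ ((1 : ℝ)/4) / (2 * Real.sqrt (Real.pi * n)) *
            Real.exp ((2 / Real.sqrt a) * (n : ℝ)^(1 - α/2))))
      atTop (nhds 1) := by
  have hmul {n : ℕ} (hn : 0 < n) :
      (n : ℝ) * (√(a * (n : ℝ) ^ α))⁻¹ = (√a)⁻¹ * (n : ℝ) ^ (1 - α / 2) := by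
    have hn' : (0 : ℝ) < n := by exact_mod_cast hn
    rw [sqrt_mul ha.le, sqrt_eq_rpow ((n : ℝ) ^ α), ← rpow_mul hn'.le, rpow_sub hn', rpow_one,
      mul_one_div]
    field_simp
  have hsq (n : ℕ) : (√(a * (n : ℝ) ^ α))⁻¹ ^ 2 = (a * (n : ℝ) ^ α)⁻¹ := by
    rw [inv_pow, sq_sqrt (by positivity)]
  have h := tendsto_sum_choose_sq_div (y := fun n : ℕ => (√(a * (n : ℝ) ^ α))⁻¹) ?_ ?_ ?_
  · refine h.congr' ?_
    filter_upwards [eventually_gt_atTop 0] with n hn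
    have hn' : (0 : ℝ) < n := by exact_mod_cast hn
    simp only [hsq]
    congr 1
    · simp only [inv_pow, div_eq_mul_inv]
    · have hA : 0 < a * (n : ℝ) ^ α := by positivity
      have h4 : (a * (n : ℝ) ^ α) ^ ((1 : ℝ) / 4) = √√(a * (n : ℝ) ^ α) := by
        rw [sqrt_eq_rpow, sqrt_eq_rpow, ← rpow_mul hA.le]
        norm_num
      have hexp : 2 * ((n : ℝ) * (√(a * (n : ℝ) ^ α))⁻¹) = 2 / √a * (n : ℝ) ^ (1 - α / 2) := by
        rw [hmul hn]; ring
      rw [hexp, h4, sqrt_mul hn'.le, sqrt_inv, sqrt_mul pi_pos.le]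
      field_simp
  · filter_upwards [eventually_gt_atTop 0] with n hn
    have hn' : (0 : ℝ) < n := by exact_mod_cast hn
    positivity
  · have h1 : Tendsto (fun n : ℕ => (√a)⁻¹ * (n : ℝ) ^ (1 - α / 2)) atTop atTop :=
      ((tendsto_rpow_atTop (by linarith)).comp tendsto_natCast_atTop_atTop).const_mul_atTop
        (by positivity)
    refine h1.congr' ?_
    filter_upwards [eventually_gt_atTop 0] with n hn
    exact (hmul hn).symm
  · have h1 : Tendsto (fun n : ℕ => a⁻¹ * (n : ℝ) ^ (-(α - 1))) atTop (nhds 0) := by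
      simpa using ((tendsto_rpow_neg_atTop (sub_pos.2 hα₁)).comp
        tendsto_natCast_atTop_atTop).const_mul a⁻¹
    refine h1.congr' ?_
    filter_upwards [eventually_gt_atTop 0] with n hn
    have hn' : (0 : ℝ) < n := by exact_mod_cast hn
    rw [hsq, neg_sub, rpow_sub hn', rpow_one]
    field_simp
end

section
/- For fixed real a > 0 and fixed α with 2/3 < α < 2, (1 + 1/√(a n^α))^{2n/(1+√(a n^α))} ∼ exp( 2n / (a n^α + √(a n^α)) ) as n → ∞, i.e., the ratio of the two sides tends to 1. -/
open Filter Real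

lemma abs_log_one_add_one_div_sub_le {s : ℝ} (hs : 0 < s) :
    |Real.log (1 + 1 / s) - 1 / s| ≤ 1 / s ^ 2 := by
  have hpos : 0 < 1 + 1 / s := by positivity
  have hlower := Real.one_sub_inv_le_log_of_pos hpos
  have hupper := Real.log_le_sub_one_of_pos hpos
  have hinv : 1 / s - 1 / s ^ 2 ≤ 1 - (1 + 1 / s)⁻¹ := by
    have h : 1 - (1 + 1 / s)⁻¹ - (1 / s - 1 / s ^ 2) = 1 / (s ^ 2 * (s + 1)) := by
      field_simp
      ring
    have : 0 < 1 / (s ^ 2 * (s + 1)) := by positivity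
    linarith
  have : 0 < 1 / s ^ 2 := by positivity
  rw [abs_le]
  constructor <;> linarith

lemma rpow_one_add_one_div_div_exp {s : ℝ} (hs : 0 < s) (x : ℝ) :
    (1 + 1 / s) ^ (x / (1 + s)) / Real.exp (x / (s ^ 2 + s)) =
      Real.exp (x / (1 + s) * (Real.log (1 + 1 / s) - 1 / s)) := by
  rw [Real.rpow_def_of_pos (by positivity), ← Real.exp_sub]
  congr 1
  field_simp
  ring

lemma tendsto_natCast_div_sqrt_pow_three {a α : ℝ} (ha : 0 < a) (hα : 2 / 3 < α) :
    Tendsto (fun n : ℕ => 2 * (n : ℝ) / Real.sqrt (a * (n : ℝ) ^ α) ^ 3) atTop (nhds 0) := by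
  have h : Tendsto (fun n : ℕ => 2 / Real.sqrt a ^ 3 * (n : ℝ) ^ (-(3 * α / 2 - 1)))
      atTop (nhds 0) := by
    simpa using ((tendsto_rpow_neg_atTop (by linarith : 0 < 3 * α / 2 - 1)).comp
      tendsto_natCast_atTop_atTop).const_mul (2 / Real.sqrt a ^ 3)
  refine h.congr' ?_
  filter_upwards [eventually_gt_atTop 0] with n hn
  have hn' : (0 : ℝ) < n := by exact_mod_cast hn
  have hpow : Real.sqrt ((n : ℝ) ^ α) ^ 3 = (n : ℝ) ^ (3 * α / 2) := by
    rw [Real.sqrt_eq_rpow, ← Real.rpow_mul hn'.le, ← Real.rpow_mul_natCast hn'.le]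
    congr 1
    push_cast
    ring
  rw [Real.sqrt_mul ha.le, mul_pow, hpow, neg_sub, Real.rpow_sub hn', Real.rpow_one]
  field_simp

theorem stmt16 (a α : ℝ) (ha : 0 < a) (hα₁ : 2/3 < α) (hα₂ : α < 2) :
    Tendsto (fun n : ℕ =>
        ((1 + 1 / Real.sqrt (a * (n : ℝ)^α)) ^
            (2 * (n : ℝ) / (1 + Real.sqrt (a * (n : ℝ)^α)))) /
          Real.exp (2 * (n : ℝ) / (a * (n : ℝ)^α + Real.sqrt (a * (n : ℝ)^α))))
      atTop (nhds 1) := by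
  have hexponent : Tendsto (fun n : ℕ => 2 * (n : ℝ) / (1 + Real.sqrt (a * (n : ℝ) ^ α)) *
      (Real.log (1 + 1 / Real.sqrt (a * (n : ℝ) ^ α)) - 1 / Real.sqrt (a * (n : ℝ) ^ α)))
      atTop (nhds 0) := by
    refine squeeze_zero_norm' ?_ (tendsto_natCast_div_sqrt_pow_three ha hα₁)
    filter_upwards [eventually_gt_atTop 0] with n hn
    have hn' : (0 : ℝ) < n := by exact_mod_cast hn
    have hs : 0 < Real.sqrt (a * (n : ℝ) ^ α) := by positivity
    generalize Real.sqrt (a * (n : ℝ) ^ α) = s at hs ⊢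
    rw [Real.norm_eq_abs, abs_mul, abs_of_pos (by positivity : 0 < 2 * (n : ℝ) / (1 + s))]
    calc 2 * (n : ℝ) / (1 + s) * |Real.log (1 + 1 / s) - 1 / s|
        ≤ 2 * (n : ℝ) / s * (1 / s ^ 2) := by
          gcongr
          · linarith
          · exact abs_log_one_add_one_div_sub_le hs
      _ = 2 * (n : ℝ) / s ^ 3 := by
          field_simp
  have hexp := (Real.continuous_exp.tendsto 0).comp hexponent
  rw [Real.exp_zero] at hexp
  refine hexp.congr' ?_
  filter_upwards [eventually_gt_atTop 0] with n hn
  have hn' : (0 : ℝ) < n := by exact_mod_cast hn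
  have hs : 0 < Real.sqrt (a * (n : ℝ) ^ α) := by positivity
  have hratio := rpow_one_add_one_div_div_exp hs (2 * (n : ℝ))
  rw [Real.sq_sqrt (by positivity)] at hratio
  exact hratio.symm
end
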